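/- arXiv:1308.4934 — 2 statements merged into one kernel-verified Lean document; each statement's English description precedes it below -/
import Mathlib

section
/- (Shapiro) Let m be a positive integer with m ∉ {1, 2, 3, 4, 6, 10, 12, 18, 30}, and let α = log 2 / log 3. Then φ(m) > m^α. -/
theorem log_two_div_log_three_pos : 0 < Real.log 2 / Real.log 3 :=
  div_pos (Real.log_pos (by norm_num)) (Real.log_pos (by norm_num))

theorem log_two_div_log_three_le : Real.log 2 / Real.log 3 ≤ 12 / 19 := by
  have h : Real.log ((2 : ℝ) ^ 19) ≤ Real.log ((3 : ℝ) ^ 12) :=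
    Real.log_le_log (by norm_num) (by norm_num)
  rw [Real.log_pow, Real.log_pow] at h
  rw [div_le_div_iff₀ (Real.log_pos (by norm_num)) (by norm_num)]
  push_cast at h
  linarith

theorem three_rpow_log_two_div_log_three : (3 : ℝ) ^ (Real.log 2 / Real.log 3) = 2 := by
  rw [Real.rpow_def_of_pos (by norm_num),
    mul_div_cancel₀ _ (Real.log_pos (by norm_num)).ne', Real.exp_log (by norm_num)]

theorem rpow_lt_of_pow_lt_pow {x c : ℝ} (hx : 1 ≤ x) (hc : 0 ≤ c) (h : x ^ 12 < c ^ 19) :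
    x ^ (Real.log 2 / Real.log 3) < c := by
  refine (Real.rpow_le_rpow_of_exponent_le hx log_two_div_log_three_le).trans_lt ?_
  refine lt_of_pow_lt_pow_left₀ 19 hc ?_
  rw [← Real.rpow_mul_natCast (by linarith)]
  norm_num
  exact_mod_cast h

theorem natCast_rpow_lt_totient_of_pow_lt_pow {d c : ℕ} (hd : 1 ≤ d) (hc : d.totient = c)
    (h : d ^ 12 < c ^ 19) : (d : ℝ) ^ (Real.log 2 / Real.log 3) < (d.totient : ℝ) := by
  rw [hc]
  exact rpow_lt_of_pow_lt_pow (by exact_mod_cast hd) (by positivity) (by exact_mod_cast h)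

theorem two_mul_prime_rpow_lt_totient {p : ℕ} (hp : p.Prime) (h7 : 7 ≤ p) :
    ((2 * p : ℕ) : ℝ) ^ (Real.log 2 / Real.log 3) < (p.totient : ℝ) := by
  have h7' : (7 : ℝ) ≤ p := by exact_mod_cast h7
  rw [Nat.totient_prime hp, Nat.cast_sub hp.one_le]
  push_cast
  refine rpow_lt_of_pow_lt_pow (by linarith) (by linarith) ?_
  have h6 : (6 : ℝ) ^ 7 ≤ ((p : ℝ) - 1) ^ 7 := by gcongr; linarith
  have hpos : 0 < ((p : ℝ) - 1) ^ 12 := pow_pos (by linarith) 12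
  calc (2 * (p : ℝ)) ^ 12 ≤ (7 / 3 * ((p : ℝ) - 1)) ^ 12 :=
        pow_le_pow_left₀ (by linarith) (by linarith) 12
    _ = (7 / 3) ^ 12 * ((p : ℝ) - 1) ^ 12 := mul_pow _ _ _
    _ < ((p : ℝ) - 1) ^ 7 * ((p : ℝ) - 1) ^ 12 := by
        gcongr
        exact lt_of_lt_of_le (by norm_num) h6
    _ = ((p : ℝ) - 1) ^ 19 := by ring

theorem prime_rpow_le_totient {p : ℕ} (hp : p.Prime) (h2 : p ≠ 2) :
    (p : ℝ) ^ (Real.log 2 / Real.log 3) ≤ (p.totient : ℝ) := by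
  rcases le_or_gt 7 p with h7 | h7
  · refine le_trans ?_ (two_mul_prime_rpow_lt_totient hp h7).le
    refine Real.rpow_le_rpow (by positivity) ?_ log_two_div_log_three_pos.le
    exact_mod_cast (by omega : p ≤ 2 * p)
  · interval_cases p
    any_goals (exfalso; revert hp; norm_num; done)
    · exact absurd rfl h2
    · rw [Nat.totient_prime hp]
      push_cast
      rw [three_rpow_log_two_div_log_three]
    · exact (natCast_rpow_lt_totient_of_pow_lt_pow (c := 4) (by norm_num) (by decide)
        (by norm_num)).le

theorem Odd.rpow_le_totient {n : ℕ} (hn : Odd n) :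
    (n : ℝ) ^ (Real.log 2 / Real.log 3) ≤ (n.totient : ℝ) := by
  induction n using Nat.recOnMul with
  | zero => simp at hn
  | one => simp
  | prime p hp => exact prime_rpow_le_totient hp (by rintro rfl; revert hn; decide)
  | mul a b iha ihb =>
    rw [Nat.odd_mul] at hn
    push_cast
    rw [Real.mul_rpow (by positivity) (by positivity)]
    calc _ ≤ (a.totient : ℝ) * b.totient :=
          mul_le_mul (iha hn.1) (ihb hn.2) (by positivity) (by positivity)
      _ ≤ _ := by exact_mod_cast Nat.totient_super_multiplicative a b

theorem Odd.two_mul_rpow_lt_totient_of_dvd {d n : ℕ} (hn : Odd n) (hdn : d ∣ n)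
    (hd : ((2 * d : ℕ) : ℝ) ^ (Real.log 2 / Real.log 3) < (d.totient : ℝ)) :
    ((2 * n : ℕ) : ℝ) ^ (Real.log 2 / Real.log 3) < (n.totient : ℝ) := by
  obtain ⟨e, rfl⟩ := hdn
  rw [Nat.odd_mul] at hn
  have he : (0 : ℝ) < e.totient := by exact_mod_cast Nat.totient_pos.2 hn.2.pos
  rw [← mul_assoc, Nat.cast_mul, Real.mul_rpow (by positivity) (by positivity)]
  calc _ < (d.totient : ℝ) * e.totient :=
        mul_lt_mul_of_lt_of_le_of_nonneg_of_pos hd hn.2.rpow_le_totient (by positivity) he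
    _ ≤ _ := by exact_mod_cast Nat.totient_super_multiplicative d e

theorem Odd.two_mul_rpow_lt_totient {n : ℕ} (hn : Odd n)
    (hS : n ∉ ({1, 3, 5, 9, 15} : Finset ℕ)) :
    ((2 * n : ℕ) : ℝ) ^ (Real.log 2 / Real.log 3) < (n.totient : ℝ) := by
  by_contra hbad
  have key (d c : ℕ) (hd : 1 ≤ d) (hc : d.totient = c) (h : (2 * d) ^ 12 < c ^ 19) :
      ¬ d ∣ n := fun hdn ↦ hbad <| hn.two_mul_rpow_lt_totient_of_dvd hdn <| by
    rw [hc]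
    exact rpow_lt_of_pow_lt_pow (by exact_mod_cast (by omega : 1 ≤ 2 * d)) (by positivity)
      (by exact_mod_cast h)
  have h25 := key 25 20 (by norm_num) (by decide) (by norm_num)
  have h27 := key 27 18 (by norm_num) (by decide) (by norm_num)
  have h45 := key 45 24 (by norm_num) (by decide) (by norm_num)
  have hprime (p : ℕ) (hp : p.Prime) (hpn : p ∣ n) : p = 3 ∨ p = 5 := by
    have h7 : p < 7 := by
      by_contra! h7
      exact hbad (hn.two_mul_rpow_lt_totient_of_dvd hpn (two_mul_prime_rpow_lt_totient hp h7))
    have hodd := hn.of_dvd_nat hpn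
    interval_cases p <;> revert hp hodd <;> decide
  have hpow (r : ℕ) (hr : r ∣ n) (h5 : ¬ 5 ∣ r) : r = 1 ∨ r = 3 ∨ r = 9 := by
    have hr0 : r ≠ 0 := (hn.of_dvd_nat hr).pos.ne'
    obtain ⟨k, rfl⟩ : ∃ k, r = 3 ^ k := ⟨_, Nat.eq_prime_pow_of_unique_prime_dvd hr0
      fun {p} hp hpr ↦ (hprime p hp (hpr.trans hr)).resolve_right (by rintro rfl; exact h5 hpr)⟩
    have hk : k < 3 := by
      by_contra! hk
      exact h27 ((pow_dvd_pow 3 hk).trans hr)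
    interval_cases k <;> simp
  simp only [Finset.mem_insert, Finset.mem_singleton] at hS
  by_cases h5 : 5 ∣ n
  · obtain ⟨r, rfl⟩ := h5
    rcases hpow r (dvd_mul_left _ _) (by omega) with rfl | rfl | rfl <;> omega
  · have := hpow n dvd_rfl h5
    omega

theorem two_pow_mul_rpow_lt_totient {d : ℕ} (hd : Even d)
    (h : (d : ℝ) ^ (Real.log 2 / Real.log 3) < (d.totient : ℝ)) (k : ℕ) :
    ((2 ^ k * d : ℕ) : ℝ) ^ (Real.log 2 / Real.log 3) < ((2 ^ k * d).totient : ℝ) := by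
  induction k with
  | zero => simpa using h
  | succ k ih =>
    have h2 : (2 : ℝ) ^ (Real.log 2 / Real.log 3) < 2 :=
      rpow_lt_of_pow_lt_pow (by norm_num) (by norm_num) (by norm_num)
    rw [pow_succ', mul_assoc, Nat.totient_mul_of_prime_of_dvd Nat.prime_two
      (hd.mul_left _).two_dvd, Nat.cast_mul, Nat.cast_mul 2 (Nat.totient _),
      Real.mul_rpow (by positivity) (by positivity)]
    exact mul_lt_mul'' (by exact_mod_cast h2) ih (by positivity) (by positivity)

theorem stmt_5 (m : ℕ) (hm : 0 < m)
    (hnot : m ∉ ({1, 2, 3, 4, 6, 10, 12, 18, 30} : Set ℕ)) :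
    (m : ℝ) ^ (Real.log 2 / Real.log 3) < (m.totient : ℝ) := by
  obtain ⟨k, n, hn, rfl⟩ := Nat.exists_eq_two_pow_mul_odd hm.ne'
  by_cases hS : n ∈ ({1, 3, 5, 9, 15} : Finset ℕ)
  · rcases lt_or_ge k 3 with hk | hk
    · simp only [Finset.mem_insert, Finset.mem_singleton] at hS
      rcases hS with rfl | rfl | rfl | rfl | rfl <;> interval_cases k <;>
        first
        | (exfalso; revert hnot; norm_num; done)
        | exact natCast_rpow_lt_totient_of_pow_lt_pow (by norm_num) rfl (by decide)
    · obtain ⟨j, rfl⟩ := Nat.exists_eq_add_of_le' hk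
      rw [pow_add, mul_assoc]
      refine two_pow_mul_rpow_lt_totient ((by decide : Even (2 ^ 3)).mul_right n) ?_ j
      simp only [Finset.mem_insert, Finset.mem_singleton] at hS
      rcases hS with rfl | rfl | rfl | rfl | rfl <;>
        exact natCast_rpow_lt_totient_of_pow_lt_pow (by norm_num) rfl (by decide)
  · have h := hn.two_mul_rpow_lt_totient hS
    rcases k with _ | k
    · rw [pow_zero, one_mul]
      refine lt_of_le_of_lt ?_ h
      refine Real.rpow_le_rpow (by positivity) ?_ log_two_div_log_three_pos.le
      exact_mod_cast (by omega : n ≤ 2 * n)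
    · rw [pow_succ, mul_assoc]
      refine two_pow_mul_rpow_lt_totient (even_two_mul n) ?_ k
      rwa [Nat.totient_mul_of_prime_of_not_dvd Nat.prime_two
        (by rwa [← even_iff_two_dvd, Nat.not_even_iff_odd]), Nat.add_one_sub_one, one_mul]
end

section
/- (Bürgisser) Let g ≥ 1 and let m be a positive integer with prime factorization m = p₁^{α₁}···p_k^{α_k}, where p₁ < ··· < p_k are primes and α_i ≥ 1. Then there exists a matrix A ∈ Sp(2g,ℤ) of order exactly m if and only if: (a) Σ_{i=2}^{k} φ(p_i^{α_i}) ≤ 2g in case m ≡ 2 (mod 4), and (b) Σ_{i=1}^{k} φ(p_i^{α_i}) ≤ 2g in case m ≢ 2 (mod 4). -/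
open Matrix

/-- The standard symplectic form matrix `J = [[0, I_g], [-I_g, 0]]` (as a block matrix). -/
def SpJ (g : ℕ) : Matrix (Fin g ⊕ Fin g) (Fin g ⊕ Fin g) ℤ :=
  Matrix.fromBlocks 0 1 (-1) 0

/-- `A` belongs to `Sp(2g, ℤ)`, i.e. `Aᵀ J A = J`. -/
def IsSymplectic (g : ℕ) (A : Matrix (Fin g ⊕ Fin g) (Fin g ⊕ Fin g) ℤ) : Prop :=
  Aᵀ * SpJ g * A = SpJ g

theorem Nat.sum_le_prod_of_two_le {α : Type*} (s : Finset α) (f : α → ℕ) (hf : ∀ i ∈ s, 2 ≤ f i) :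
    ∑ i ∈ s, f i ≤ ∏ i ∈ s, f i := by
  classical
  induction s using Finset.induction_on with
  | empty => simp
  | insert a s ha ih =>
    rw [Finset.sum_insert ha, Finset.prod_insert ha]
    have h1 := ih fun i hi => hf i (Finset.mem_insert_of_mem hi)
    have h2 := hf a (Finset.mem_insert_self a s)
    rcases s.eq_empty_or_nonempty with rfl | ⟨b, hb⟩
    · simp
    · have h3 : f b ≤ ∏ i ∈ s, f i := (Finset.single_le_sum (fun _ _ => Nat.zero_le _) hb).trans h1
      have h4 := hf b (Finset.mem_insert_of_mem hb)
      nlinarith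

theorem Nat.two_le_totient_prime_pow {p k : ℕ} (hp : p.Prime) (hk : k ≠ 0) (h : p ^ k ≠ 2) :
    2 ≤ (p ^ k).totient := by
  have h1 : 1 < p ^ k := Nat.one_lt_pow hk hp.one_lt
  have h2 : 0 < (p ^ k).totient := Nat.totient_pos.2 (by omega)
  have h3 : (p ^ k).totient ≠ 1 := by
    rw [Ne, Nat.totient_eq_one_iff]; omega
  omega

theorem Nat.sum_totient_prime_pow_le_totient {d : ℕ} (hd : d ≠ 0) :
    ∑ p ∈ d.primeFactors with p ^ d.factorization p ≠ 2, (p ^ d.factorization p).totient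
      ≤ d.totient := by
  have h1 : d.totient = ∏ p ∈ d.primeFactors, (p ^ d.factorization p).totient := by
    rw [Nat.multiplicative_factorization Nat.totient (fun _ _ h => Nat.totient_mul h)
      Nat.totient_one hd]
    rfl
  rw [h1]
  refine (Nat.sum_le_prod_of_two_le _ _ fun p hp => ?_).trans
    (Finset.prod_le_prod_of_subset_of_one_le' (Finset.filter_subset _ _) fun p hp _ => ?_)
  · rw [Finset.mem_filter] at hp
    exact Nat.two_le_totient_prime_pow (Nat.prime_of_mem_primeFactors hp.1)
      (Finsupp.mem_support_iff.1 hp.1) hp.2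
  · exact Nat.totient_pos.2 (Nat.pos_of_ne_zero
      (pow_ne_zero _ (Nat.prime_of_mem_primeFactors hp).ne_zero))

theorem Nat.sum_totient_prime_pow_le_sum_totient {m : ℕ} (D : Finset ℕ)
    (hD : ∀ d ∈ D, d ≠ 0)
    (h : ∀ p ∈ m.primeFactors, ∃ d ∈ D, d.factorization p = m.factorization p) :
    ∑ p ∈ m.primeFactors with p ^ m.factorization p ≠ 2, (p ^ m.factorization p).totient
      ≤ ∑ d ∈ D, d.totient := by
  choose! c hcD hc using h
  calc _ ≤ ∑ d ∈ D, ∑ p ∈ (m.primeFactors.filter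
            (fun p => p ^ m.factorization p ≠ 2)).filter (fun p => c p = d),
          (p ^ m.factorization p).totient := by
        rw [Finset.sum_fiberwise_of_maps_to]
        exact fun p hp => hcD p (Finset.mem_filter.1 hp).1
    _ ≤ _ := by
        refine Finset.sum_le_sum fun d hd => ?_
        refine le_trans ?_ (Nat.sum_totient_prime_pow_le_totient (hD d hd))
        rw [Finset.sum_congr rfl (g := fun p => (p ^ d.factorization p).totient)]
        · refine Finset.sum_le_sum_of_subset fun p hp => ?_
          simp only [Finset.mem_filter] at hp ⊢
          obtain ⟨⟨hp, h2⟩, rfl⟩ := hp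
          have := hc p hp
          rw [this]
          refine ⟨?_, h2⟩
          rw [← Nat.support_factorization, Finsupp.mem_support_iff] at hp ⊢
          rwa [this]
        · intro p hp
          simp only [Finset.mem_filter] at hp
          obtain ⟨⟨hp, h2⟩, rfl⟩ := hp
          rw [hc p hp]

open Polynomial in
theorem Matrix.exists_cyclotomic_orders {ι : Type*} [Fintype ι] [DecidableEq ι]
    (A : Matrix ι ι ℚ) {m : ℕ} (hm : 0 < m) (hA : orderOf A = m) :
    ∃ D : Finset ℕ, (∀ d ∈ D, d ≠ 0) ∧
      (∀ p ∈ m.primeFactors, ∃ d ∈ D, d.factorization p = m.factorization p) ∧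
      ∑ d ∈ D, d.totient ≤ Fintype.card ι := by
  classical
  have hdvd : minpoly ℚ A ∣ X ^ m - 1 := minpoly.dvd _ _ (by simp [← hA, pow_orderOf_eq_one])
  set D := m.divisors.filter (fun d => cyclotomic d ℚ ∣ minpoly ℚ A) with hDdef
  have hD0 : ∀ d ∈ D, d ∣ m ∧ cyclotomic d ℚ ∣ minpoly ℚ A := fun d hd => by
    simpa [hDdef, hm.ne'] using hd
  have hpos : ∀ d ∈ D, d ≠ 0 := fun d hd => (Nat.pos_of_dvd_of_pos (hD0 d hd).1 hm).ne'
  have hmin : minpoly ℚ A ∣ ∏ d ∈ D, cyclotomic d ℚ := by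
    rw [← prod_cyclotomic_eq_X_pow_sub_one hm, ← Finset.prod_filter_mul_prod_filter_not _
      (fun d => cyclotomic d ℚ ∣ minpoly ℚ A)] at hdvd
    refine IsCoprime.dvd_of_dvd_mul_right (IsCoprime.prod_right fun d hd => ?_) hdvd
    rw [Finset.mem_filter] at hd
    exact (((cyclotomic.irreducible_rat (Nat.pos_of_mem_divisors hd.1)).coprime_iff_not_dvd).2
      hd.2).symm
  refine ⟨D, hpos, fun p hp => ?_, ?_⟩
  · by_contra! hcon
    have hpp := Nat.prime_of_mem_primeFactors hp
    have hpm := Nat.dvd_of_mem_primeFactors hp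
    have hmp : 0 < m / p := Nat.div_pos (Nat.le_of_dvd hm hpm) hpp.pos
    have hall : ∀ d ∈ D, d ∣ m / p := fun d hd => by
      rw [← Nat.factorization_le_iff_dvd (hpos d hd) hmp.ne', Nat.factorization_div hpm]
      intro q
      have h1 := (Nat.factorization_le_iff_dvd (hpos d hd) hm.ne').2 (hD0 d hd).1 q
      by_cases hq : q = p
      · subst hq
        have := hcon d hd
        simp [hpp.factorization]
        omega
      · simpa [hpp.factorization, Finsupp.single_apply, Ne.symm hq] using h1
    have h2 : minpoly ℚ A ∣ X ^ (m / p) - 1 := by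
      refine hmin.trans ?_
      rw [← prod_cyclotomic_eq_X_pow_sub_one hmp]
      exact Finset.prod_dvd_prod_of_subset _ _ _ fun d hd =>
        Nat.mem_divisors.2 ⟨hall d hd, hmp.ne'⟩
    have h3 : A ^ (m / p) = 1 := by
      have := (minpoly.dvd_iff).1 h2
      simpa [sub_eq_zero] using this
    have h4 := Nat.le_of_dvd hmp (hA ▸ orderOf_dvd_of_pow_eq_one h3)
    exact absurd h4 (not_le.2 (Nat.div_lt_self hm hpp.one_lt))
  · have h1 : ∏ d ∈ D, cyclotomic d ℚ ∣ A.charpoly := by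
      refine (Finset.prod_dvd_of_coprime (fun d hd e he hde => ?_)
        fun d hd => (hD0 d hd).2).trans (Matrix.minpoly_dvd_charpoly A)
      exact cyclotomic.isCoprime_rat hde
    have h2 := natDegree_le_of_dvd h1 A.charpoly_monic.ne_zero
    rw [Matrix.charpoly_natDegree_eq_dim, natDegree_prod_of_monic _ _
      fun d _ => cyclotomic.monic d ℚ] at h2
    simpa [natDegree_cyclotomic] using h2

theorem Matrix.sum_totient_le_card_of_orderOf_eq {ι : Type*} [Fintype ι] [DecidableEq ι]
    (A : Matrix ι ι ℤ) {m : ℕ} (hm : 0 < m) (hA : orderOf A = m) :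
    ∑ p ∈ m.primeFactors with p ^ m.factorization p ≠ 2, (p ^ m.factorization p).totient
      ≤ Fintype.card ι := by
  have hinj : Function.Injective ((Int.castRingHom ℚ).mapMatrix (m := ι)) :=
    Matrix.map_injective Int.cast_injective
  obtain ⟨D, h0, h1, h2⟩ := Matrix.exists_cyclotomic_orders ((Int.castRingHom ℚ).mapMatrix A) hm
    ((orderOf_injective ((Int.castRingHom ℚ).mapMatrix (m := ι)).toMonoidHom hinj A).trans hA)
  exact (Nat.sum_totient_prime_pow_le_sum_totient D h0 h1).trans h2

/-- The `k × k` block companion matrix of `X ^ k - a` over a possibly noncommutative ring. -/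
def Matrix.cyclicRoot {R : Type*} [Ring R] (k : ℕ) (a : R) : Matrix (Fin k) (Fin k) R :=
  Matrix.of fun i j => if (i : ℕ) = j + 1 then 1 else if (i : ℕ) + k = j + 1 then a else 0

theorem Matrix.mul_cyclicRoot_apply {R : Type*} [Ring R] {k : ℕ} (a : R)
    {n : Type*} (M : Matrix n (Fin k) R) (i : n) (j : Fin k) :
    (M * cyclicRoot k a) i j =
      if h : (j : ℕ) + 1 < k then M i ⟨j + 1, h⟩ else M i ⟨0, j.pos⟩ * a := by
  rw [Matrix.mul_apply]
  split_ifs with h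
  · rw [Finset.sum_eq_single ⟨j + 1, h⟩]
    · simp [cyclicRoot]
    · intro l _ hl
      have h1 : (l : ℕ) ≠ j + 1 := fun h => hl (Fin.ext h)
      have h2 : (l : ℕ) + k ≠ j + 1 := by omega
      simp [cyclicRoot, h1, h2]
    · simp
  · have hj : (j : ℕ) + 1 = k := by omega
    rw [Finset.sum_eq_single ⟨0, j.pos⟩]
    · simp [cyclicRoot, hj, j.pos.ne]
    · intro l _ hl
      have h1 : (l : ℕ) ≠ j + 1 := by omega
      have h2 : (l : ℕ) ≠ 0 := fun h => hl (Fin.ext h)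
      have h3 : (l : ℕ) + k ≠ j + 1 := by omega
      simp [cyclicRoot, h1, h3]
    · simp

theorem Matrix.cyclicRoot_pow_apply {R : Type*} [Ring R] {k : ℕ} (a : R) {t : ℕ} (ht : t ≤ k)
    (i j : Fin k) : (cyclicRoot k a ^ t) i j =
      if (i : ℕ) = j + t then 1 else if (i : ℕ) + k = j + t then a else 0 := by
  induction t generalizing j with
  | zero =>
    have : (i : ℕ) + k ≠ j := by omega
    simp [Matrix.one_apply, Fin.ext_iff, this]
  | succ t ih =>
    rw [pow_succ, mul_cyclicRoot_apply]
    split_ifs <;> rw [ih (by omega)] <;> dsimp only <;> split_ifs <;> first | omega | simp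

theorem Matrix.cyclicRoot_pow_self {R : Type*} [Ring R] {k : ℕ} (a : R) :
    cyclicRoot k a ^ k = diagonal fun _ => a := by
  ext i j
  rw [cyclicRoot_pow_apply a le_rfl, diagonal_apply]
  split_ifs <;> simp_all [Fin.ext_iff] <;> omega

/-- The block companion matrix preserves the block diagonal form whenever its corner entry
preserves the form on each block. -/
theorem Matrix.cyclicRoot_preserves_diagonal {κ : Type*} [Fintype κ] [DecidableEq κ] {k : ℕ}
    {A W : Matrix κ κ ℤ} (hA : Aᵀ * W * A = W) :
    ((cyclicRoot k A)ᵀ.map transpose) * diagonal (fun _ => W) * cyclicRoot k A =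
      diagonal fun _ => W := by
  ext1 i j
  rw [mul_cyclicRoot_apply, diagonal_apply]
  simp only [mul_diagonal, map_apply, transpose_apply, cyclicRoot, of_apply]
  split_ifs <;> simp_all [Fin.ext_iff] <;> omega

theorem Matrix.exists_symplectic_root {ι : Type*} [Fintype ι] [DecidableEq ι] {k : ℕ} (hk : 0 < k)
    {A : Matrix (ι ⊕ ι) (ι ⊕ ι) ℤ} (hA : A ∈ symplecticGroup ι ℤ) :
    ∃ B ∈ symplecticGroup (Fin k × ι) ℤ, ∀ t, B ^ (k * t) = 1 ↔ A ^ t = 1 := by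
  have : Nonempty (Fin k) := ⟨⟨0, hk⟩⟩
  rw [SymplecticGroup.mem_iff'] at hA
  have hB := cyclicRoot_preserves_diagonal (k := k) hA
  set e := Equiv.prodSumDistrib (Fin k) ι ι
  set F := (compRingEquiv (Fin k) (ι ⊕ ι) ℤ).trans (reindexRingEquiv ℤ e) with hF
  refine ⟨F (cyclicRoot k A), ?_, fun t => ?_⟩
  · rw [SymplecticGroup.mem_iff']
    have h1 : F (diagonal fun _ => J ι ℤ) = J (Fin k × ι) ℤ := by
      ext i j
      rcases i with ⟨i, x⟩ | ⟨i, x⟩ <;> rcases j with ⟨j, y⟩ | ⟨j, y⟩ <;>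
        by_cases h : i = j <;> by_cases h' : x = y <;>
        simp [hF, e, J, h, h']
    have h2 : (F (cyclicRoot k A))ᵀ = F ((cyclicRoot k A)ᵀ.map transpose) := rfl
    rw [← h1, h2, ← map_mul, ← map_mul, hB]
  · rw [← map_pow, pow_mul, cyclicRoot_pow_self, diagonal_pow, map_eq_one_iff F F.injective,
      ← diagonal_one, diagonal_eq_diagonal_iff]
    simp

theorem Matrix.exists_symplectic_sum {ι κ : Type*} [Fintype ι] [DecidableEq ι] [Fintype κ]
    [DecidableEq κ] {A : Matrix (ι ⊕ ι) (ι ⊕ ι) ℤ} (hA : A ∈ symplecticGroup ι ℤ)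
    {B : Matrix (κ ⊕ κ) (κ ⊕ κ) ℤ} (hB : B ∈ symplecticGroup κ ℤ) :
    ∃ C ∈ symplecticGroup (ι ⊕ κ) ℤ, orderOf C = (orderOf A).lcm (orderOf B) := by
  rw [SymplecticGroup.mem_iff'] at hA hB
  set F := reindexRingEquiv ℤ (Equiv.sumSumSumComm ι ι κ κ) with hF
  refine ⟨F (fromBlocks A 0 0 B), ?_, ?_⟩
  · rw [SymplecticGroup.mem_iff']
    have h1 : F (fromBlocks (J ι ℤ) 0 0 (J κ ℤ)) = J (ι ⊕ κ) ℤ := by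
      ext i j
      rcases i with (i | i) | (i | i) <;> rcases j with (j | j) | (j | j) <;>
        simp [hF, J, one_apply]
    have h2 : (F (fromBlocks A 0 0 B))ᵀ = F ((fromBlocks A 0 0 B)ᵀ) := rfl
    rw [← h1, h2, ← map_mul, ← map_mul, fromBlocks_transpose, fromBlocks_multiply,
      fromBlocks_multiply]
    simp [hA, hB]
  · refine Nat.dvd_antisymm ?_ ?_
    · rw [orderOf_dvd_iff_pow_eq_one, ← map_pow, map_eq_one_iff F F.injective,
        fromBlocks_diagonal_pow, orderOf_dvd_iff_pow_eq_one.1 (Nat.dvd_lcm_left _ _),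
        orderOf_dvd_iff_pow_eq_one.1 (Nat.dvd_lcm_right _ _), fromBlocks_one]
    · have h := pow_orderOf_eq_one (F (fromBlocks A 0 0 B))
      rw [← map_pow, map_eq_one_iff F F.injective, fromBlocks_diagonal_pow, ← fromBlocks_one,
        fromBlocks_inj] at h
      exact Nat.lcm_dvd (orderOf_dvd_of_pow_eq_one h.1) (orderOf_dvd_of_pow_eq_one h.2.2.2)

theorem Matrix.exists_symplectic_reindex {ι κ : Type*} [Fintype ι] [DecidableEq ι] [Fintype κ]
    [DecidableEq κ] (e : ι ≃ κ) {A : Matrix (ι ⊕ ι) (ι ⊕ ι) ℤ} (hA : A ∈ symplecticGroup ι ℤ) :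
    ∃ B ∈ symplecticGroup κ ℤ, orderOf B = orderOf A := by
  rw [SymplecticGroup.mem_iff'] at hA
  set F := reindexRingEquiv ℤ (Equiv.sumCongr e e) with hF
  refine ⟨F A, ?_, MulEquiv.orderOf_eq F.toMulEquiv A⟩
  rw [SymplecticGroup.mem_iff']
  have h1 : F (J ι ℤ) = J κ ℤ := by
    ext i j
    rcases i with i | i <;> rcases j with j | j <;> simp [hF, J, one_apply]
  have h2 : (F A)ᵀ = F Aᵀ := rfl
  rw [← h1, h2, ← map_mul, ← map_mul, hA]

theorem Fin.sum_ite_val_eq {M : Type*} [AddCommMonoid M] {h : ℕ} (n : ℕ) (f : Fin h → M) :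
    ∑ k : Fin h, (if (k : ℕ) = n then f k else 0) = if hn : n < h then f ⟨n, hn⟩ else 0 := by
  split_ifs with hn
  · rw [Finset.sum_eq_single ⟨n, hn⟩]
    · simp
    · intro b _ hb
      rw [if_neg fun h => hb (Fin.ext h)]
    · simp
  · exact Finset.sum_eq_zero fun k _ => if_neg (by omega)

/-- The `h × h` matrix of `fᵢ ↦ fᵢ₊₁ - fᵢ`, with `f_h = 0`. -/
def Matrix.forwardDiff (h : ℕ) : Matrix (Fin h) (Fin h) ℤ :=
  of fun k i => (if (k : ℕ) = i + 1 then 1 else 0) - if (k : ℕ) = i then 1 else 0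

/-- The `h × h` matrix with entries `1` on and above the diagonal. -/
def Matrix.upperOnes (h : ℕ) : Matrix (Fin h) (Fin h) ℤ :=
  of fun l i => if (l : ℕ) ≤ i then 1 else 0

/-- The `h × h` matrix with entries `-1` in the last column. -/
def Matrix.lastColNegOne (h : ℕ) : Matrix (Fin h) (Fin h) ℤ :=
  of fun _ i => if (i : ℕ) + 1 = h then -1 else 0

theorem Matrix.mul_forwardDiff_apply {n : Type*} {h : ℕ} (M : Matrix n (Fin h) ℤ) (i : n)
    (j : Fin h) : (M * forwardDiff h) i j =
      (if hj : (j : ℕ) + 1 < h then M i ⟨j + 1, hj⟩ else 0) - M i j := by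
  simp only [Matrix.mul_apply, forwardDiff, of_apply, mul_sub, mul_ite, mul_one, mul_zero,
    Finset.sum_sub_distrib, Fin.sum_ite_val_eq, Fin.eta, j.2, dite_true]

theorem Matrix.mul_lastColNegOne_apply {n : Type*} {h : ℕ} (M : Matrix n (Fin h) ℤ) (i : n)
    (j : Fin h) : (M * lastColNegOne h) i j = if (j : ℕ) + 1 = h then -∑ k, M i k else 0 := by
  split_ifs with hj <;> simp [Matrix.mul_apply, lastColNegOne, hj]

theorem Matrix.sum_forwardDiff {h : ℕ} (k : Fin h) :
    ∑ j, forwardDiff h k j = if (k : ℕ) = 0 then -1 else 0 := by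
  have h1 : ∀ j : Fin h, (k : ℕ) = j + 1 ↔ (j : ℕ) = k - 1 ∧ 0 < (k : ℕ) := by omega
  have h2 : (k : ℕ) - 1 < h := by omega
  simp only [forwardDiff, of_apply, Finset.sum_sub_distrib, h1, ite_and, eq_comm (a := (k : ℕ)),
    Fin.sum_ite_val_eq, h2, k.2, dite_true]
  split_ifs <;> omega

theorem Matrix.sum_lastColNegOne {h : ℕ} (k : Fin h) : ∑ j, lastColNegOne h k j = -1 := by
  have h1 : ∀ j : Fin h, (j : ℕ) + 1 = h ↔ (j : ℕ) = h - 1 := by omega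
  have h2 : h - 1 < h := Nat.sub_one_lt k.pos.ne'
  simp only [lastColNegOne, of_apply, h1, Fin.sum_ite_val_eq, h2, dite_true]

/-- A symplectic matrix of size `2 * h` and order `2 * h + 1`: the action of the cyclic shift on
`ℤ ^ (2 * h + 1)` modulo the span of `(1, …, 1)`, written in a symplectic basis of the invariant form
`ω(eᵢ, eᵢ₊₁) = 1`. -/
def Matrix.symplecticCycle (h : ℕ) : Matrix (Fin h ⊕ Fin h) (Fin h ⊕ Fin h) ℤ :=
  fromBlocks 0 (forwardDiff h) (upperOnes h) (lastColNegOne h)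

theorem Matrix.upperOnes_transpose_mul_forwardDiff (h : ℕ) :
    (upperOnes h)ᵀ * forwardDiff h = -1 := by
  ext i j
  rw [mul_forwardDiff_apply]
  simp only [upperOnes, transpose_apply, of_apply, neg_apply, one_apply, Fin.ext_iff]
  split_ifs <;> omega

theorem Matrix.lastColNegOne_transpose_mul_forwardDiff (h : ℕ) :
    (lastColNegOne h)ᵀ * forwardDiff h = (forwardDiff h)ᵀ * lastColNegOne h := by
  rw [← transpose_transpose ((forwardDiff h)ᵀ * lastColNegOne h), transpose_mul,
    transpose_transpose]
  ext i j
  rw [transpose_apply, mul_forwardDiff_apply, mul_forwardDiff_apply]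
  simp only [lastColNegOne, transpose_apply, of_apply]
  split_ifs <;> omega

theorem Matrix.symplecticCycle_mem (h : ℕ) : symplecticCycle h ∈ symplecticGroup (Fin h) ℤ := by
  have h1 := upperOnes_transpose_mul_forwardDiff h
  have h2 : (forwardDiff h)ᵀ * upperOnes h = -1 := by
    rw [← transpose_transpose (upperOnes h), ← transpose_mul, h1]
    simp
  rw [SymplecticGroup.mem_iff', symplecticCycle, J, fromBlocks_transpose, fromBlocks_multiply,
    fromBlocks_multiply]
  simp [h1, h2, lastColNegOne_transpose_mul_forwardDiff]

theorem Matrix.symplecticCycle_sq_mulVec (h : ℕ) (i : Fin h) :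
    (symplecticCycle h ^ 2) *ᵥ Pi.single (Sum.inr i) 1 =
      if hi : (i : ℕ) + 1 < h then Pi.single (Sum.inr ⟨i + 1, hi⟩) 1
      else Pi.single (Sum.inl ⟨0, i.pos⟩) 1 := by
  rw [mulVec_single_one, pow_two, symplecticCycle, fromBlocks_multiply]
  ext (k | l)
  · rw [col_apply, fromBlocks_apply₁₂, Matrix.zero_mul, zero_add, mul_lastColNegOne_apply,
      sum_forwardDiff]
    split_ifs <;> first | omega | simp_all [Pi.single_apply, Fin.ext_iff]
  · rw [col_apply, fromBlocks_apply₂₂, add_apply, mul_lastColNegOne_apply, mul_forwardDiff_apply,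
      sum_lastColNegOne]
    simp only [upperOnes, of_apply]
    split_ifs <;> simp [Pi.single_apply, Fin.ext_iff] <;> omega

theorem Matrix.symplecticCycle_mulVec_inr (h : ℕ) (i : Fin h) (hi : (i : ℕ) + 1 < h) :
    symplecticCycle h *ᵥ Pi.single (Sum.inr i) 1 =
      Pi.single (Sum.inl ⟨i + 1, hi⟩) 1 - Pi.single (Sum.inl i) 1 := by
  rw [mulVec_single_one, symplecticCycle]
  ext (k | l)
  · simp [Pi.single_apply, Fin.ext_iff, forwardDiff]
  · simp [lastColNegOne, hi.ne]

theorem Matrix.symplecticCycle_pow_mulVec (h : ℕ) (i : ℕ) (hi : i < h) :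
    (symplecticCycle h ^ (2 * i + 1)) *ᵥ Pi.single (Sum.inl ⟨0, by omega⟩) 1 =
      Pi.single (Sum.inr ⟨i, hi⟩) 1 := by
  induction i with
  | zero =>
    rw [mul_zero, zero_add, pow_one, mulVec_single_one, symplecticCycle]
    ext (k | l)
    · simp
    · simp [Pi.single_apply, Fin.ext_iff, upperOnes, -Fin.val_fin_le]
  | succ i ih =>
    rw [show 2 * (i + 1) + 1 = 2 + (2 * i + 1) by ring, pow_add, ← mulVec_mulVec, ih (by omega),
      symplecticCycle_sq_mulVec, dif_pos]

theorem Matrix.symplecticCycle_pow_eq_one (h : ℕ) : symplecticCycle h ^ (2 * h + 1) = 1 := by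
  set A := symplecticCycle h with hA
  set B := A ^ (2 * h + 1) with hB
  rcases h.eq_zero_or_pos with rfl | hh
  · exact Subsingleton.elim _ _
  have h0 : B *ᵥ Pi.single (Sum.inl ⟨0, hh⟩) 1 = Pi.single (Sum.inl ⟨0, hh⟩) 1 := by
    rw [hB, show 2 * h + 1 = 2 + (2 * (h - 1) + 1) by omega, pow_add, ← mulVec_mulVec, hA,
      symplecticCycle_pow_mulVec h (h - 1) (by omega), symplecticCycle_sq_mulVec, dif_neg]
    dsimp only
    omega
  have hcomm : ∀ t, B * A ^ t = A ^ t * B := fun t => by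
    rw [hB, ← pow_add, ← pow_add, add_comm]
  have hr : ∀ i, B *ᵥ Pi.single (Sum.inr i) 1 = Pi.single (Sum.inr i) 1 := fun i => by
    rw [← symplecticCycle_pow_mulVec h i i.2, ← hA, mulVec_mulVec, hcomm, ← mulVec_mulVec, h0]
  have hl : ∀ i, ∀ hi : i < h,
      B *ᵥ Pi.single (Sum.inl ⟨i, hi⟩) 1 = Pi.single (Sum.inl ⟨i, hi⟩) 1 := fun i => by
    induction i with
    | zero => exact fun _ => h0
    | succ i ih =>
      intro hi
      have h1 := symplecticCycle_mulVec_inr h ⟨i, by omega⟩ hi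
      rw [← hA] at h1
      have h2 := congrArg (B *ᵥ ·) h1
      have h3 := hcomm 1
      rw [pow_one] at h3
      simp only [mulVec_mulVec, mulVec_sub, ih] at h2
      rw [h3, ← mulVec_mulVec, hr, h1] at h2
      exact (sub_left_injective h2).symm
  refine ext_of_mulVec_single fun i => ?_
  rw [one_mulVec]
  rcases i with i | i
  · exact hl i i.2
  · exact hr i

theorem Matrix.symplecticCycle_ne_one {h : ℕ} (hh : 0 < h) : symplecticCycle h ≠ 1 := by
  intro H
  have := congrFun (congrFun H (Sum.inl ⟨0, hh⟩)) (Sum.inl ⟨0, hh⟩)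
  simp [symplecticCycle] at this

theorem Matrix.exists_symplectic_prime_pow {p a : ℕ} (hp : p.Prime) (ha : a ≠ 0)
    (hpa : p ^ a ≠ 2) :
    ∃ n, 2 * n = (p ^ a).totient ∧ ∃ A ∈ symplecticGroup (Fin n) ℤ, orderOf A = p ^ a := by
  have : Fact p.Prime := ⟨hp⟩
  obtain ⟨b, rfl⟩ := Nat.exists_eq_succ_of_ne_zero ha
  suffices H : ∃ k n, 0 < k ∧ 2 * (k * n) = (p ^ (b + 1)).totient ∧
      ∃ A ∈ symplecticGroup (Fin n) ℤ, ∃ c, p ^ b = k * p ^ c ∧ A ^ p ^ c ≠ 1 ∧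
        A ^ p ^ (c + 1) = 1 by
    obtain ⟨k, n, hk, hn, A, hA, c, hc, hA1, hA2⟩ := H
    obtain ⟨B, hB, hBA⟩ := exists_symplectic_root hk hA
    obtain ⟨C, hC, hCB⟩ := exists_symplectic_reindex finProdFinEquiv hB
    refine ⟨k * n, hn, C, hC, hCB.trans (orderOf_eq_prime_pow ?_ ?_)⟩
    · rwa [hc, hBA]
    · rwa [pow_succ, hc, mul_assoc, ← pow_succ, hBA]
  rw [Nat.totient_prime_pow_succ hp]
  rcases hp.eq_two_or_odd' with rfl | ⟨h, rfl⟩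
  · obtain ⟨c, rfl⟩ := Nat.exists_eq_succ_of_ne_zero (show b ≠ 0 by rintro rfl; simp at hpa)
    refine ⟨2 ^ c, 1, by positivity, by rw [pow_succ]; ring, J (Fin 1) ℤ,
      SymplecticGroup.J_mem _ _, 1, by rw [pow_succ, pow_one], ?_, ?_⟩
    · rw [pow_one, pow_two, J_squared]
      intro h
      simpa using congrFun (congrFun h (Sum.inl 0)) (Sum.inl 0)
    · rw [show 2 ^ (1 + 1) = 2 * 2 by norm_num, pow_mul, pow_two (J _ _), J_squared]
      simp
  · have hh : 0 < h := Nat.pos_of_ne_zero fun h0 => hp.ne_one (by simp [h0])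
    refine ⟨(2 * h + 1) ^ b, h, by positivity, by rw [Nat.add_sub_cancel]; ring,
      symplecticCycle h, symplecticCycle_mem h, 0, by simp, ?_, ?_⟩
    · simpa using symplecticCycle_ne_one hh
    · simpa using symplecticCycle_pow_eq_one h

theorem Matrix.exists_symplectic_prod_prime_pow (e : ℕ → ℕ) (s : Finset ℕ)
    (hs : ∀ p ∈ s, p.Prime ∧ e p ≠ 0 ∧ p ^ e p ≠ 2) :
    ∃ n, 2 * n = ∑ p ∈ s, (p ^ e p).totient ∧
      ∃ A ∈ symplecticGroup (Fin n) ℤ, orderOf A = ∏ p ∈ s, p ^ e p := by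
  induction s using Finset.induction_on with
  | empty => exact ⟨0, rfl, 1, one_mem _, orderOf_one⟩
  | insert p s hps ih =>
    obtain ⟨n, hn, A, hA, hAo⟩ := ih fun q hq => hs q (Finset.mem_insert_of_mem hq)
    obtain ⟨hp, h0, h2⟩ := hs p (Finset.mem_insert_self p s)
    obtain ⟨k, hk, B, hB, hBo⟩ := exists_symplectic_prime_pow hp h0 h2
    obtain ⟨C, hC, hCo⟩ := exists_symplectic_sum hB hA
    obtain ⟨D, hD, hDo⟩ := exists_symplectic_reindex finSumFinEquiv hC
    refine ⟨k + n, by rw [Finset.sum_insert hps, mul_add, hk, hn], D, hD, ?_⟩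
    rw [hDo, hCo, hBo, hAo, Finset.prod_insert hps]
    refine (Nat.Coprime.prod_right fun q hq => Nat.Coprime.pow _ _ ?_).lcm_eq_mul
    exact (Nat.coprime_primes hp (hs q (Finset.mem_insert_of_mem hq)).1).2
      fun h => hps (h ▸ hq)

theorem Matrix.exists_symplectic_of_le {n g : ℕ} (h : n ≤ g)
    {A : Matrix (Fin n ⊕ Fin n) (Fin n ⊕ Fin n) ℤ} (hA : A ∈ symplecticGroup (Fin n) ℤ) :
    ∃ B ∈ symplecticGroup (Fin g) ℤ, orderOf B = orderOf A := by
  obtain ⟨k, rfl⟩ := Nat.exists_eq_add_of_le h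
  obtain ⟨C, hC, hCo⟩ := exists_symplectic_sum hA (one_mem (symplecticGroup (Fin k) ℤ))
  obtain ⟨D, hD, hDo⟩ := exists_symplectic_reindex finSumFinEquiv hC
  exact ⟨D, hD, by simpa [hCo] using hDo⟩

theorem orderOf_neg_of_odd {R : Type*} [Ring R] [Nontrivial R] (hR : ringChar R ≠ 2) (x : R)
    (hx : Odd (orderOf x)) : orderOf (-x) = 2 * orderOf x := by
  have h1 : orderOf (-1 : R) = 2 := by rw [orderOf_neg_one, if_neg hR]
  rw [← neg_one_mul, (Commute.neg_one_left x).orderOf_mul_eq_mul_orderOf_of_coprime, h1]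
  rw [h1]
  exact hx.coprime_two_left

theorem Nat.filter_primeFactors_pow_ne_two {m : ℕ} (hm : 0 < m) :
    m.primeFactors.filter (fun p => p ^ m.factorization p ≠ 2) =
      if m % 4 = 2 then m.primeFactors.erase 2 else m.primeFactors := by
  have h2 : 2 ∈ m.primeFactors → (2 ^ m.factorization 2 = 2 ↔ m % 4 = 2) := fun h => by
    have h4 : 4 ∣ m ↔ 2 ≤ m.factorization 2 :=
      Nat.prime_two.pow_dvd_iff_le_factorization (k := 2) hm.ne'
    have h5 : m.factorization 2 ≠ 0 := by
      rwa [← Nat.support_factorization, Finsupp.mem_support_iff] at h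
    have h6 := Nat.dvd_of_mem_primeFactors h
    rw [Nat.pow_eq_self_iff (by norm_num)]
    omega
  ext p
  have h3 : p ∈ m.primeFactors → p ^ m.factorization p = 2 → p = 2 := fun hp h =>
    (Nat.prime_dvd_prime_iff_eq (Nat.prime_of_mem_primeFactors hp) Nat.prime_two).1
      (h ▸ dvd_pow_self p (by rintro h0; simp [h0] at h))
  split_ifs with h <;> simp only [Finset.mem_filter, Finset.mem_erase]
  · constructor
    · rintro ⟨hp, hne⟩
      exact ⟨by rintro rfl; exact hne ((h2 hp).2 h), hp⟩
    · rintro ⟨hne, hp⟩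
      exact ⟨hp, fun h' => hne (h3 hp h')⟩
  · refine ⟨And.left, fun hp => ⟨hp, fun h' => h ?_⟩⟩
    obtain rfl := h3 hp h'
    exact (h2 hp).1 h'

theorem isSymplectic_iff_mem_symplecticGroup {g : ℕ}
    {A : Matrix (Fin g ⊕ Fin g) (Fin g ⊕ Fin g) ℤ} :
    IsSymplectic g A ↔ A ∈ symplecticGroup (Fin g) ℤ := by
  have h : SpJ g = -J (Fin g) ℤ := by simp [SpJ, J, fromBlocks_neg]
  rw [IsSymplectic, SymplecticGroup.mem_iff', h]
  simp

theorem stmt_6 (g m : ℕ) (hg : 1 ≤ g) (hm : 0 < m) :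
    (∃ A : Matrix (Fin g ⊕ Fin g) (Fin g ⊕ Fin g) ℤ,
        IsSymplectic g A ∧ orderOf A = m) ↔
      ((m % 4 = 2 →
          ∑ p ∈ m.primeFactors.erase 2, (p ^ m.factorization p).totient ≤ 2 * g) ∧
        (m % 4 ≠ 2 →
          ∑ p ∈ m.primeFactors, (p ^ m.factorization p).totient ≤ 2 * g)) := by
  have hfilter := Nat.filter_primeFactors_pow_ne_two hm
  have hprod : ∏ p ∈ m.primeFactors, p ^ m.factorization p = m :=
    Nat.prod_factorization_pow_eq_self hm.ne'
  set s := m.primeFactors.filter fun p => p ^ m.factorization p ≠ 2 with hs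
  trans ∑ p ∈ s, (p ^ m.factorization p).totient ≤ 2 * g
  swap
  · rw [hfilter]
    split_ifs with h <;> simp [h]
  constructor
  · rintro ⟨A, -, hA⟩
    simpa [two_mul] using Matrix.sum_totient_le_card_of_orderOf_eq A hm hA
  · intro hle
    obtain ⟨n, hn, A, hA, hAo⟩ :=
      Matrix.exists_symplectic_prod_prime_pow m.factorization s fun p hp => by
        rw [hs, Finset.mem_filter, ← Nat.support_factorization, Finsupp.mem_support_iff] at hp
        exact ⟨by_contra fun h => hp.1 (Nat.factorization_eq_zero_of_not_prime m h), hp⟩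
    obtain ⟨B, hB, hBA⟩ := Matrix.exists_symplectic_of_le (show n ≤ g by omega) hA
    rw [hAo, hfilter] at hBA
    split_ifs at hBA with h
    · have h2 : 2 ∈ m.primeFactors := Nat.mem_primeFactors.2 ⟨Nat.prime_two, by omega, hm.ne'⟩
      have h3 : 2 ^ m.factorization 2 = 2 := by
        by_contra h'
        have : 2 ∈ s := Finset.mem_filter.2 ⟨h2, h'⟩
        simp [hfilter, h] at this
      rw [← Finset.mul_prod_erase _ _ h2, h3, ← hBA] at hprod
      have : Nonempty (Fin g) := ⟨⟨0, hg⟩⟩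
      refine ⟨-B, isSymplectic_iff_mem_symplecticGroup.2 (SymplecticGroup.neg_mem hB), ?_⟩
      rw [orderOf_neg_of_odd _ B (Nat.odd_iff.2 (by omega)), hprod]
      rw [ringChar.eq _ 0]
      norm_num
    · exact ⟨B, isSymplectic_iff_mem_symplecticGroup.2 hB, hBA.trans hprod⟩
end
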